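/- For all integers l ≥ 2 and m ≥ 1, the toughness of G(L⁽²⁾,x,y,l,m) equals (l + 3m)/(1 + 2m). -/

import Mathlib

open SimpleGraph

/-- Number of connected components of the subgraph induced on the complement of `S`. -/
noncomputable def numComponents {V : Type} (G : SimpleGraph V) (S : Set V) : ℕ :=
  Nat.card (G.induce Sᶜ).ConnectedComponent

/-- `G` is `t`-tough: `|S| ≥ t · ω(G \ S)` for every vertex subset `S`
with `ω(G \ S) > 1`. -/
def IsTough {V : Type} (t : ℝ) (G : SimpleGraph V) : Prop :=
  ∀ S : Finset V, 1 < numComponents G ↑S →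
    t * (numComponents G ↑S : ℝ) ≤ (S.card : ℝ)

/-- The toughness of `G` equals `t`: `t` is the greatest nonnegative real
for which `G` is `t`-tough. -/
def HasToughness {V : Type} (G : SimpleGraph V) (t : ℝ) : Prop :=
  IsGreatest {s : ℝ | 0 ≤ s ∧ IsTough s G} t

/-- A Hamiltonian cycle: a cycle whose support contains every vertex. -/
def IsHamCycle {V : Type} {G : SimpleGraph V} {v : V} (p : G.Walk v v) : Prop :=
  p.IsCycle ∧ ∀ u, u ∈ p.support

/-- A graph is Hamiltonian if it contains a Hamiltonian cycle. -/
def IsHam {V : Type} (G : SimpleGraph V) : Prop :=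
  ∃ (v : V) (p : G.Walk v v), IsHamCycle p

/-- `x` and `y` are connected by a Hamilton path of `G`: a path with endpoints
`x` and `y` containing every vertex of `G`. -/
def HamConnected {V : Type} (G : SimpleGraph V) (x y : V) : Prop :=
  ∃ p : G.Walk x y, p.IsPath ∧ ∀ v, v ∈ p.support

/-- `L⁽¹⁾`: the 8-cycle `w₁w₂…w₈w₁` (here `wᵢ = i - 1`) together with the
edges `w₂w₄, w₄w₆, w₆w₈, w₂w₈`; `x = w₁ = 0`, `y = w₅ = 4`. -/
def L1 : SimpleGraph (Fin 8) := SimpleGraph.fromEdgeSet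
  {s(0,1), s(1,2), s(2,3), s(3,4), s(4,5), s(5,6), s(6,7), s(7,0),
   s(1,3), s(3,5), s(5,7), s(1,7)}

/-- `L⁽²⁾`: obtained from `L⁽¹⁾` by deleting `w₁w₂, w₂w₈` and identifying `w₂`
with `w₈`.  Vertices `w₁, w, w₃, w₄, w₅, w₆, w₇` are `0, 1, 2, 3, 4, 5, 6`;
`x = w₁ = 0`, `y = w₅ = 4`. -/
def L2 : SimpleGraph (Fin 7) := SimpleGraph.fromEdgeSet
  {s(0,1), s(1,2), s(2,3), s(3,4), s(4,5), s(5,6), s(6,1),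
   s(1,3), s(3,5), s(5,1)}

/-- `L⁽³⁾`: obtained from `L⁽¹⁾` by adding a new vertex `w₉ = 8` and the edges
`w₄w₉, w₆w₉`; `x = w₁ = 0`, `y = w₅ = 4`. -/
def L3 : SimpleGraph (Fin 9) := SimpleGraph.fromEdgeSet
  {s(0,1), s(1,2), s(2,3), s(3,4), s(4,5), s(5,6), s(6,7), s(7,0),
   s(1,3), s(3,5), s(5,7), s(1,7), s(3,8), s(5,8)}

/-- `L⁽⁴⁾`: the triangle `w₁w₂w₃w₁` together with pendant vertices `w₄, w₅`
and edges `w₁w₄, w₃w₅` (here `wᵢ = i - 1`); `x = w₄ = 3`, `y = w₅ = 4`. -/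
def L4 : SimpleGraph (Fin 5) := SimpleGraph.fromEdgeSet
  {s(0,1), s(1,2), s(2,0), s(0,3), s(2,4)}

/-- A building block: a graph together with two distinguished vertices. -/
structure Block where
  V : Type
  G : SimpleGraph V
  x : V
  y : V

/-- The graph `G(L,x,y,l,m)` (allowing a different block for each of the `m`
copies): disjoint copies `L₁, …, Lₘ` of the blocks, all possible edges between
pairs of vertices in `{x₁, …, xₘ, y₁, …, yₘ}`, joined with a complete graph
`T = Kₗ`. -/
def GGen {m : ℕ} (l : ℕ) (B : Fin m → Block) :
    SimpleGraph (Fin l ⊕ Σ i, (B i).V) :=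
  SimpleGraph.fromRel fun a b =>
    (∃ t, a = Sum.inl t) ∨ (∃ t, b = Sum.inl t) ∨
    (∃ (i : Fin m) (u v : (B i).V),
      a = Sum.inr ⟨i, u⟩ ∧ b = Sum.inr ⟨i, v⟩ ∧ (B i).G.Adj u v) ∨
    (∃ p q : Σ i, (B i).V, a = Sum.inr p ∧ b = Sum.inr q ∧
      (p.2 = (B p.1).x ∨ p.2 = (B p.1).y) ∧ (q.2 = (B q.1).x ∨ q.2 = (B q.1).y))

def blockL1 : Block := ⟨Fin 8, L1, 0, 4⟩
def blockL2 : Block := ⟨Fin 7, L2, 0, 4⟩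
def blockL3 : Block := ⟨Fin 9, L3, 0, 4⟩
def blockL4 : Block := ⟨Fin 5, L4, 3, 4⟩

instance : DecidableRel L2.Adj := fun a b =>
  decidable_of_iff
    (s(a, b) ∈ ({s(0,1), s(1,2), s(2,3), s(3,4), s(4,5), s(5,6), s(6,1),
      s(1,3), s(3,5), s(5,1)} : Finset (Sym2 (Fin 7))) ∧ a ≠ b) (by
    simp [L2, SimpleGraph.fromEdgeSet_adj])

/-- After deleting `A` from `L⁽²⁾`, every remaining vertex is within distance two of `x`, of `y`,
or of one of at most `min 2 (2|A|/3)` further vertices. -/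
theorem L2_exists_representatives (A : Finset (Fin 7)) :
    ∃ R : Finset (Fin 7), R.card ≤ 2 ∧ 3 * R.card ≤ 2 * A.card ∧
      ∀ v ∉ A, ∃ u ∉ A, (u ∈ R ∨ u = 0 ∨ u = 4) ∧
        ∃ w ∉ A, (v = w ∨ L2.Adj v w) ∧ (w = u ∨ L2.Adj w u) := by
  revert A
  decide +kernel

theorem GGen_adj_inl {m : ℕ} {l : ℕ} {B : Fin m → Block} (t : Fin l)
    {b : Fin l ⊕ Σ i, (B i).V} (h : b ≠ Sum.inl t) : (GGen l B).Adj (Sum.inl t) b :=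
  (SimpleGraph.fromRel_adj _ _ _).2 ⟨h.symm, Or.inl (Or.inl ⟨t, rfl⟩)⟩

theorem GGen_adj_block {m : ℕ} {l : ℕ} {B : Fin m → Block} {i : Fin m} {u v : (B i).V}
    (h : (B i).G.Adj u v) : (GGen l B).Adj (Sum.inr ⟨i, u⟩) (Sum.inr ⟨i, v⟩) :=
  (SimpleGraph.fromRel_adj _ _ _).2
    ⟨by simpa using h.ne, Or.inl (Or.inr (Or.inr (Or.inl ⟨i, u, v, rfl, rfl, h⟩)))⟩

theorem GGen_adj_ends {m : ℕ} {l : ℕ} {B : Fin m → Block} {p q : Σ i, (B i).V} (h : p ≠ q)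
    (hp : p.2 = (B p.1).x ∨ p.2 = (B p.1).y) (hq : q.2 = (B q.1).x ∨ q.2 = (B q.1).y) :
    (GGen l B).Adj (Sum.inr p) (Sum.inr q) :=
  (SimpleGraph.fromRel_adj _ _ _).2
    ⟨by simpa using h, Or.inl (Or.inr (Or.inr (Or.inr ⟨p, q, rfl, rfl, hp, hq⟩)))⟩

theorem SimpleGraph.induce_reachable_of_eq_or_adj {V : Type*} {G : SimpleGraph V} {s : Set V}
    {a b : V} (ha : a ∈ s) (hb : b ∈ s) (h : a = b ∨ G.Adj a b) :
    (G.induce s).Reachable ⟨a, ha⟩ ⟨b, hb⟩ := by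
  rcases h with rfl | h
  · exact .refl _
  · exact SimpleGraph.Adj.reachable (by simpa using h)

/-- A set with several components in its complement contains every vertex of `T`. -/
theorem inl_mem_of_one_lt_numComponents {m l : ℕ} {B : Fin m → Block}
    {S : Set (Fin l ⊕ Σ i, (B i).V)} (h : 1 < numComponents (GGen l B) S) (t : Fin l) :
    Sum.inl t ∈ S := by
  by_contra ht
  have key (v : ↥Sᶜ) : ((GGen l B).induce Sᶜ).Reachable ⟨Sum.inl t, ht⟩ v :=
    SimpleGraph.induce_reachable_of_eq_or_adj _ v.2
      ((eq_or_ne v.1 (Sum.inl t)).imp Eq.symm (GGen_adj_inl t))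
  have : Subsingleton ((GGen l B).induce Sᶜ).ConnectedComponent :=
    SimpleGraph.Preconnected.subsingleton_connectedComponent
      fun u v => (key u).symm.trans (key v)
  exact absurd h (not_lt.2 (Finite.card_le_one_iff_subsingleton.2 this))

/-- If every vertex outside `S ⊇ T` is joined, within its own block, to a distinguished vertex or
to one of the vertices listed in `R`, then `G ∖ S` has at most `1 + ∑ |R i|` components. -/
theorem numComponents_GGen_le {m l : ℕ} {B : Fin m → Block}
    {S : Set (Fin l ⊕ Σ i, (B i).V)} (hT : ∀ t, Sum.inl t ∈ S) (R : ∀ i, Finset (B i).V)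
    (hR : ∀ (i : Fin m) (v : (B i).V) (hv : Sum.inr ⟨i, v⟩ ∈ Sᶜ),
      ∃ (u : (B i).V) (hu : Sum.inr ⟨i, u⟩ ∈ Sᶜ), (u ∈ R i ∨ u = (B i).x ∨ u = (B i).y) ∧
        ((GGen l B).induce Sᶜ).Reachable ⟨Sum.inr ⟨i, v⟩, hv⟩ ⟨Sum.inr ⟨i, u⟩, hu⟩) :
    numComponents (GGen l B) S ≤ 1 + ∑ i, (R i).card := by
  let H := (GGen l B).induce Sᶜ
  let P : Option (Σ i, (B i).V) → H.ConnectedComponent → Prop := fun o c =>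
    match o with
    | none => ∃ (p : Σ i, (B i).V) (hp : Sum.inr p ∈ Sᶜ),
        (p.2 = (B p.1).x ∨ p.2 = (B p.1).y) ∧ H.connectedComponentMk ⟨Sum.inr p, hp⟩ = c
    | some p => ∃ hp : Sum.inr p ∈ Sᶜ, H.connectedComponentMk ⟨Sum.inr p, hp⟩ = c
  have huniq : ∀ o c c', P o c → P o c' → c = c' := by
    rintro (_ | p) c c'
    · rintro ⟨p, hp, hpe, rfl⟩ ⟨q, hq, hqe, rfl⟩
      refine SimpleGraph.ConnectedComponent.sound
        (SimpleGraph.induce_reachable_of_eq_or_adj _ _ ?_)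
      rcases eq_or_ne p q with rfl | hpq
      · exact Or.inl rfl
      · exact Or.inr (GGen_adj_ends hpq hpe hqe)
    · rintro ⟨hp, rfl⟩ ⟨_, rfl⟩
      rfl
  let F : Finset (Option (Σ i, (B i).V)) := Finset.insertNone (Finset.univ.sigma R)
  have hex : ∀ c : H.ConnectedComponent, ∃ o : F, P o c := by
    refine SimpleGraph.ConnectedComponent.ind ?_
    rintro ⟨t | ⟨i, v⟩, hv⟩
    · exact absurd (hT t) hv
    · obtain ⟨u, hu, hor, hreach⟩ := hR i v hv
      have heq := (SimpleGraph.ConnectedComponent.sound hreach).symm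
      rcases hor with hur | hend
      · exact ⟨⟨some ⟨i, u⟩, by simp [F, hur]⟩, hu, heq⟩
      · exact ⟨⟨none, by simp [F]⟩, ⟨i, u⟩, hu, hend, heq⟩
  choose f hf using hex
  have hinj : Function.Injective f := fun c c' h => huniq _ _ _ (hf c) (h ▸ hf c')
  calc numComponents (GGen l B) S ≤ Nat.card F := Nat.card_le_card_of_injective f hinj
    _ = 1 + ∑ i, (R i).card := by
      rw [Nat.card_eq_fintype_card, Fintype.card_coe, Finset.card_insertNone,
        Finset.card_sigma, add_comm]

theorem Finset.card_univ_disjSum_sigma (l : ℕ) {ι : Type*} [Fintype ι] {β : ι → Type*}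
    (A : ∀ i, Finset (β i)) :
    ((Finset.univ : Finset (Fin l)).disjSum (Finset.univ.sigma A)).card =
      l + ∑ i, (A i).card := by
  rw [Finset.card_disjSum, Finset.card_sigma, Finset.card_univ, Fintype.card_fin]

theorem isTough_GGen_L2 (l m : ℕ) (hl : 2 ≤ l) :
    IsTough (((l : ℝ) + 3 * m) / (1 + 2 * m)) (GGen l (fun _ : Fin m => blockL2)) := by
  classical
  intro S hS
  have hT := inl_mem_of_one_lt_numComponents hS
  let A : Fin m → Finset (Fin 7) := fun i =>
    Finset.univ.filter fun u : Fin 7 => (Sum.inr ⟨i, u⟩ : Fin l ⊕ Σ _ : Fin m, blockL2.V) ∈ S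
  have hA (i : Fin m) (u : Fin 7) :
      u ∈ A i ↔ (Sum.inr ⟨i, u⟩ : Fin l ⊕ Σ _ : Fin m, blockL2.V) ∈ S := by simp [A]
  choose R hR2 hR3 hR using fun i => L2_exists_representatives (A i)
  have hcomp : numComponents (GGen l (fun _ : Fin m => blockL2)) ↑S ≤ 1 + ∑ i, (R i).card := by
    refine numComponents_GGen_le hT R fun i v hv => ?_
    obtain ⟨u, hu, hor, w, hw, hvw, hwu⟩ := hR i v (fun h => hv ((hA i v).1 h))
    have step {a b : Fin 7} (h : a = b ∨ L2.Adj a b) :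
        (Sum.inr ⟨i, a⟩ : Fin l ⊕ Σ _ : Fin m, blockL2.V) = Sum.inr ⟨i, b⟩ ∨
          (GGen l (fun _ : Fin m => blockL2)).Adj (Sum.inr ⟨i, a⟩) (Sum.inr ⟨i, b⟩) :=
      h.imp (by rintro rfl; rfl) fun h =>
        GGen_adj_block (B := fun _ : Fin m => blockL2) (i := i) h
    exact ⟨u, fun h => hu ((hA i u).2 h), hor,
      (SimpleGraph.induce_reachable_of_eq_or_adj hv
        (show Sum.inr ⟨i, w⟩ ∈ (↑S : Set (Fin l ⊕ Σ _ : Fin m, blockL2.V))ᶜ from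
          fun h => hw ((hA i w).2 h))
        (step hvw)).trans (SimpleGraph.induce_reachable_of_eq_or_adj _ _ (step hwu))⟩
  have hcard : l + ∑ i, (A i).card ≤ S.card := by
    have hsub : (Finset.univ : Finset (Fin l)).disjSum
        ((Finset.univ : Finset (Fin m)).sigma A) ⊆ S := by
      rintro (t | ⟨i, u⟩) h
      · exact hT t
      · exact (hA i u).1 (by simpa using h)
    exact (Finset.card_univ_disjSum_sigma l A).ge.trans (Finset.card_le_card hsub)
  have h2 : ∑ i, (R i).card ≤ 2 * m := by
    simpa [mul_comm] using Finset.sum_le_card_nsmul Finset.univ _ 2 fun i _ => hR2 i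
  have h3 : 3 * ∑ i, (R i).card ≤ 2 * ∑ i, (A i).card := by
    simpa only [Finset.mul_sum] using Finset.sum_le_sum fun i _ => hR3 i
  generalize ∑ i, (R i).card = C at *
  generalize ∑ i, (A i).card = D at *
  have hl' : (2 : ℝ) ≤ l := by exact_mod_cast hl
  have hcomp' : (numComponents (GGen l (fun _ : Fin m => blockL2)) ↑S : ℝ) ≤ 1 + C := by
    exact_mod_cast hcomp
  have hcard' : (l : ℝ) + D ≤ S.card := by exact_mod_cast hcard
  have h2' : (C : ℝ) ≤ 2 * m := by exact_mod_cast h2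
  have h3' : 3 * (C : ℝ) ≤ 2 * D := by exact_mod_cast h3
  have hm' : (0 : ℝ) ≤ m := m.cast_nonneg
  refine (mul_le_mul_of_nonneg_left hcomp' (by positivity)).trans (le_trans ?_ hcard')
  rw [div_mul_eq_mul_div, div_le_iff₀ (by positivity)]
  nlinarith [mul_nonneg (sub_nonneg.2 hl') (sub_nonneg.2 h2'),
    mul_nonneg hm' (sub_nonneg.2 h3')]

/-- The set `{w, w₄, w₆}` of vertices of `L⁽²⁾`. -/
def L2CutBlock : Finset blockL2.V :=
  show Finset (Fin 7) from {1, 3, 5}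

/-- The set `T ∪ {w, w₄, w₆ of each copy}`, which attains the toughness. -/
def L2Cut (l m : ℕ) : Finset (Fin l ⊕ Σ _ : Fin m, blockL2.V) :=
  (Finset.univ : Finset (Fin l)).disjSum ((Finset.univ : Finset (Fin m)).sigma fun _ => L2CutBlock)

theorem card_L2Cut (l m : ℕ) : (L2Cut l m).card = l + 3 * m := by
  rw [L2Cut, Finset.card_univ_disjSum_sigma, Finset.sum_const, Finset.card_univ,
    Fintype.card_fin, show L2CutBlock.card = 3 from rfl, smul_eq_mul, mul_comm]

theorem inl_mem_L2Cut {l m : ℕ} (t : Fin l) : Sum.inl t ∈ L2Cut l m := by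
  simp [L2Cut]

theorem inr_mem_L2Cut {l m : ℕ} {i : Fin m} {u : blockL2.V} :
    Sum.inr ⟨i, u⟩ ∈ L2Cut l m ↔ u ∈ L2CutBlock := by
  simp [L2Cut]

/-- Labels of the vertices isolated in `L⁽²⁾` by the deletion of `L2CutBlock`. -/
def L2BlockLabel : Fin 7 → Option Bool :=
  ![none, none, some true, none, none, none, some false]

/-- Labels of the components left by `L2Cut`: `w₃` and `w₇` are isolated in each copy, and all
copies of `x` and `y` form one component. -/
def L2CutLabel (l m : ℕ) : (Fin l ⊕ Σ _ : Fin m, blockL2.V) → Option (Fin m × Bool)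
  | Sum.inl _ => none
  | Sum.inr p => (L2BlockLabel p.2).map (Prod.mk p.1)

theorem L2CutLabel_eq_of_adj {l m : ℕ} {a b : Fin l ⊕ Σ _ : Fin m, blockL2.V}
    (ha : a ∉ L2Cut l m) (hb : b ∉ L2Cut l m)
    (h : (GGen l (fun _ : Fin m => blockL2)).Adj a b) :
    L2CutLabel l m a = L2CutLabel l m b := by
  have hblock : ∀ u v : Fin 7, u ∉ ({1, 3, 5} : Finset (Fin 7)) →
      v ∉ ({1, 3, 5} : Finset (Fin 7)) → ¬ L2.Adj u v := by decide +kernel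
  have hend (p : Σ _ : Fin m, blockL2.V) (hp : p.2 = blockL2.x ∨ p.2 = blockL2.y) :
      L2CutLabel l m (Sum.inr p) = none := by
    obtain ⟨i, u⟩ := p
    rcases hp with hp | hp <;> cases hp <;> rfl
  have key {a b : Fin l ⊕ Σ _ : Fin m, blockL2.V} (ha : a ∉ L2Cut l m) (hb : b ∉ L2Cut l m)
      (h : (∃ t, a = Sum.inl t) ∨ (∃ t, b = Sum.inl t) ∨
        (∃ (i : Fin m) (u v : blockL2.V),
          a = Sum.inr ⟨i, u⟩ ∧ b = Sum.inr ⟨i, v⟩ ∧ blockL2.G.Adj u v) ∨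
        (∃ p q : Σ _ : Fin m, blockL2.V, a = Sum.inr p ∧ b = Sum.inr q ∧
          (p.2 = blockL2.x ∨ p.2 = blockL2.y) ∧ (q.2 = blockL2.x ∨ q.2 = blockL2.y))) :
      L2CutLabel l m a = L2CutLabel l m b := by
    rcases h with ⟨t, rfl⟩ | ⟨t, rfl⟩ | ⟨i, u, v, rfl, rfl, huv⟩ | ⟨p, q, rfl, rfl, hp, hq⟩
    · exact absurd (inl_mem_L2Cut t) ha
    · exact absurd (inl_mem_L2Cut t) hb
    · exact absurd huv (hblock u v (mt inr_mem_L2Cut.2 ha) (mt inr_mem_L2Cut.2 hb))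
    · rw [hend p hp, hend q hq]
  rcases ((SimpleGraph.fromRel_adj _ _ _).1 h).2 with h | h
  · exact key ha hb h
  · exact (key hb ha h).symm

theorem le_numComponents_L2Cut (l m : ℕ) (hm : 1 ≤ m) :
    1 + 2 * m ≤ numComponents (GGen l (fun _ : Fin m => blockL2)) ↑(L2Cut l m) := by
  let H := (GGen l (fun _ : Fin m => blockL2)).induce (↑(L2Cut l m) : Set _)ᶜ
  have hwalk (v w : ↥(↑(L2Cut l m) : Set (Fin l ⊕ Σ _ : Fin m, blockL2.V))ᶜ) (p : H.Walk v w) :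
      L2CutLabel l m v = L2CutLabel l m w := by
    induction p with
    | nil => rfl
    | @cons a b _ h _ ih =>
      exact (L2CutLabel_eq_of_adj a.2 b.2 (SimpleGraph.comap_adj.1 h)).trans ih
  let g : H.ConnectedComponent → Option (Fin m × Bool) :=
    SimpleGraph.ConnectedComponent.lift (fun v => L2CutLabel l m v) fun v w p _ => hwalk v w p
  have hmem (i : Fin m) (u : Fin 7) (hu : u ∉ ({1, 3, 5} : Finset (Fin 7))) :
      Sum.inr ⟨i, u⟩ ∈ (↑(L2Cut l m) : Set (Fin l ⊕ Σ _ : Fin m, blockL2.V))ᶜ :=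
    mt inr_mem_L2Cut.1 hu
  have hg : Function.Surjective g := by
    rintro (_ | ⟨i, _ | _⟩)
    · exact ⟨H.connectedComponentMk ⟨_, hmem ⟨0, hm⟩ 0 (by decide)⟩, rfl⟩
    · exact ⟨H.connectedComponentMk ⟨_, hmem i 6 (by decide)⟩, rfl⟩
    · exact ⟨H.connectedComponentMk ⟨_, hmem i 2 (by decide)⟩, rfl⟩
  have : Finite blockL2.V := inferInstanceAs (Finite (Fin 7))
  calc 1 + 2 * m = Nat.card (Option (Fin m × Bool)) := by
        simp [add_comm, mul_comm]
    _ ≤ Nat.card H.ConnectedComponent := Nat.card_le_card_of_surjective g hg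

/-- Claim 3: for `l ≥ 2` and `m ≥ 1`,
`τ(G(L⁽²⁾,x,y,l,m)) = (l + 3m)/(1 + 2m)`. -/
theorem toughness_GGen_L2 (l m : ℕ) (hl : 2 ≤ l) (hm : 1 ≤ m) :
    HasToughness (GGen l (fun _ : Fin m => blockL2))
      (((l : ℝ) + 3 * m) / (1 + 2 * m)) := by
  refine ⟨⟨by positivity, isTough_GGen_L2 l m hl⟩, fun s ⟨hs, hst⟩ => ?_⟩
  have hle := le_numComponents_L2Cut l m hm
  have hcut := hst (L2Cut l m) (by omega)
  rw [card_L2Cut] at hcut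
  push_cast at hcut
  rw [le_div_iff₀ (by positivity)]
  refine le_trans (mul_le_mul_of_nonneg_left ?_ hs) hcut
  exact_mod_cast hle
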